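/- Let α > 0 and let Σ ⊆ ℕ be a multiplicative semigroup with liminf_{N→∞} #(Σ ∩ [1,N])/N^α > 0. Let μ be a Σ-invariant Borel probability measure on 𝕋 = ℝ/ℤ which is ergodic for the Σ-action. If h_μ(T_p) = 0 for some p ∈ Σ with p ≥ 2, then μ is supported on finitely many points. -/

import Mathlib

open MeasureTheory Filter

/-- The image in `ℝ/ℤ` of the real interval `(a, b]`. -/
noncomputable def arc (a b : ℝ) : Set (AddCircle (1:ℝ)) :=
  (fun x : ℝ => (x : AddCircle (1:ℝ))) '' Set.Ioc a b

/-- The measure-theoretic entropy of `x ↦ p • x` on `ℝ/ℤ` with respect to `μ`, computed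
using the generating partition into the `p` arcs `((j-1)/p, j/p]`. -/
noncomputable def padicEntropy (p : ℕ) (μ : Measure (AddCircle (1:ℝ))) : ℝ :=
  atTop.limsup (fun n : ℕ => (1 / (n : ℝ)) *
    ∑ k ∈ Finset.range (p ^ n),
      Real.negMulLog ((μ (arc ((k : ℝ) / (p : ℝ) ^ n) (((k : ℝ) + 1) / (p : ℝ) ^ n))).toReal))

/-- Maximal partial Birkhoff sums. -/
noncomputable def mxs {X : Type*} (T : X → X) (f : X → ℝ) : ℕ → X → ℝ
  | 0 => fun _ => 0
  | (n+1) => fun x => max 0 (f x + mxs T f n (T x))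

lemma mxs_nonneg {X : Type*} (T : X → X) (f : X → ℝ) (n : ℕ) (x : X) : 0 ≤ mxs T f n x := by
  cases n with
  | zero => simp [mxs]
  | succ n => simp [mxs]

lemma mxs_mono {X : Type*} (T : X → X) (f : X → ℝ) (n : ℕ) : ∀ x : X,
    mxs T f n x ≤ mxs T f (n+1) x := by
  induction n with
  | zero => intro x; simp [mxs]
  | succ n ih =>
    intro x
    rw [mxs, mxs]
    have := ih (T x)
    exact max_le_max le_rfl (by linarith)

lemma sum_le_mxs {X : Type*} (T : X → X) (f : X → ℝ) (n : ℕ) : ∀ x : X,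
    ∑ j ∈ Finset.range n, f (T^[j] x) ≤ mxs T f n x := by
  induction n with
  | zero => intro x; simp [mxs]
  | succ n ih =>
    intro x
    rw [Finset.sum_range_succ', mxs]
    have := ih (T x)
    simp only [Function.iterate_succ, Function.comp_apply, Function.iterate_zero, id]
    exact le_max_of_le_right (by linarith)

lemma maximal_ineq {X : Type*} [MeasurableSpace X] (μ : Measure X) [IsProbabilityMeasure μ]
    (T : X → X) (hT : MeasurePreserving T μ μ) (g : X → ℝ) (hgm : Measurable g)
    (hg : Integrable g μ) (hg0 : ∀ x, 0 ≤ g x) (ε : ℝ) (hε : 0 < ε) (hlt : ∫ x, g x ∂μ < ε) :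
    ∃ Y : Set X, 0 < μ Y ∧ ∀ x ∈ Y, ∀ n : ℕ,
      ∑ j ∈ Finset.range n, g (T^[j] x) ≤ ε * n := by
  set f : X → ℝ := fun x => g x - ε with hf
  have hfm : Measurable f := hgm.sub_const _
  have hfi : Integrable f μ := hg.sub (integrable_const _)
  have hMm : ∀ n, Measurable (mxs T f n) := by
    intro n
    induction n with
    | zero => exact measurable_const
    | succ n ih => exact measurable_const.max (hfm.add (ih.comp hT.measurable))
  have hMi : ∀ n, Integrable (mxs T f n) μ := by
    intro n
    induction n with
    | zero => exact integrable_const (0:ℝ)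
    | succ n ih =>
      exact (integrable_const (0:ℝ)).sup (hfi.add (hT.integrable_comp_of_integrable ih))
  set E : ℕ → Set X := fun n => {x | 0 < mxs T f n x} with hE
  have hEm : ∀ n, MeasurableSet (E n) := fun n => measurableSet_lt measurable_const (hMm n)
  have hEb : ∀ n, μ.real (E n) ≤ (∫ x, g x ∂μ) / ε := by
    intro n
    have key : 0 ≤ ∫ x, (E n).indicator f x ∂μ := by
      have h1 : ∫ x, (mxs T f n x - mxs T f n (T x)) ∂μ = 0 := by
        have hc : Integrable (fun x => mxs T f n (T x)) μ :=
          hT.integrable_comp_of_integrable (hMi n)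
        rw [integral_sub (hMi n) hc]
        have := integral_map hT.measurable.aemeasurable (μ := μ) (f := mxs T f n)
          (hMm n).aestronglyMeasurable
        rw [hT.map_eq] at this
        rw [this, sub_self]
      rw [← h1]
      apply integral_mono ((hMi n).sub (hT.integrable_comp_of_integrable (hMi n)))
        (hfi.indicator (hEm n))
      intro x
      change mxs T f n x - mxs T f n (T x) ≤ (E n).indicator f x
      by_cases hx : x ∈ E n
      · rw [Set.indicator_of_mem hx]
        cases n with
        | zero => simp [hE, mxs] at hx
        | succ n =>
          have h2 := mxs_mono T f n (T x)
          have h3 : mxs T f (n+1) x = f x + mxs T f n (T x) := by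
            simp only [hE, mxs, Set.mem_ofPred_eq, lt_max_iff, lt_irrefl, false_or] at hx
            rw [mxs]
            exact max_eq_right hx.le
          linarith
      · rw [Set.indicator_of_notMem hx]
        have h2 := mxs_nonneg T f n (T x)
        simp only [hE, Set.mem_ofPred_eq, not_lt] at hx
        linarith
    rw [integral_indicator (hEm n)] at key
    simp only [hf] at key
    rw [integral_sub hg.integrableOn (integrable_const _)] at key
    have h4 : ∫ x in E n, g x ∂μ ≤ ∫ x, g x ∂μ :=
      setIntegral_le_integral hg (Eventually.of_forall hg0)
    rw [setIntegral_const, smul_eq_mul] at key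
    rw [le_div_iff₀ hε]
    linarith
  have hmono : Monotone E := by
    apply monotone_nat_of_le_succ
    intro n x hx
    exact lt_of_lt_of_le hx (mxs_mono T f n x)
  have hU : μ (⋃ n, E n) ≤ ENNReal.ofReal ((∫ x, g x ∂μ) / ε) := by
    rw [hmono.measure_iUnion]
    apply iSup_le
    intro n
    rw [← ofReal_measureReal]
    exact ENNReal.ofReal_le_ofReal (hEb n)
  have hU1 : μ (⋃ n, E n) < 1 := by
    apply hU.trans_lt
    rw [ENNReal.ofReal_lt_one]
    rwa [div_lt_one hε]
  refine ⟨(⋃ n, E n)ᶜ, ?_, ?_⟩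
  · rw [prob_compl_eq_one_sub (MeasurableSet.iUnion hEm)]
    exact tsub_pos_of_lt hU1
  · intro x hx n
    simp only [Set.mem_compl_iff, Set.mem_iUnion, not_exists, hE, Set.mem_ofPred_eq, not_lt] at hx
    have h5 := (sum_le_mxs T f n x).trans (hx n)
    simp only [hf, Finset.sum_sub_distrib, Finset.sum_const, Finset.card_range, nsmul_eq_mul] at h5
    linarith

/-- An atom forces finite support. -/
lemma finite_of_atom (S : Set ℕ) (hS : ∀ a ∈ S, ∀ b ∈ S, a * b ∈ S)
    (μ : Measure (AddCircle (1:ℝ))) [IsProbabilityMeasure μ]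
    (hinv : ∀ n ∈ S, ∀ A : Set (AddCircle (1:ℝ)), MeasurableSet A →
      μ ((fun x : AddCircle (1:ℝ) => n • x) ⁻¹' A) = μ A)
    (herg : ∀ A : Set (AddCircle (1:ℝ)), MeasurableSet A →
      (∀ n ∈ S, (fun x : AddCircle (1:ℝ) => n • x) ⁻¹' A = A) → μ A = 0 ∨ μ A = 1)
    (p : ℕ) (hpS : p ∈ S) (r : AddCircle (1:ℝ)) (hr : 0 < μ {r}) :
    ∃ F : Set (AddCircle (1:ℝ)), F.Finite ∧ μ F = 1 := by
  have hm : ∀ n : ℕ, Measurable (fun x : AddCircle (1:ℝ) => n • x) :=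
    fun n => (continuous_nsmul n).measurable
  set D : Set (AddCircle (1:ℝ)) := {x | μ {r} ≤ μ {x}} with hD
  have hfin : D.Finite := by
    have := Measure.finite_const_le_meas_of_disjoint_iUnion μ hr (As := fun x => {x})
      (fun x => MeasurableSet.singleton x)
      (fun x y hxy => by simpa using hxy) (measure_ne_top _ _)
    exact this
  have hfwd : ∀ n ∈ S, ∀ x ∈ D, n • x ∈ D := by
    intro n hn x hx
    simp only [hD, Set.mem_ofPred_eq] at hx ⊢
    rw [← hinv n hn {n • x} (MeasurableSet.singleton _)]
    exact hx.trans (measure_mono (by simp))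
  refine ⟨D, hfin, ?_⟩
  set D' : Set (AddCircle (1:ℝ)) := ⋃ m ∈ S, (fun x : AddCircle (1:ℝ) => m • x) ⁻¹' D with hD'
  have hDm := hfin.measurableSet
  have hD'm : MeasurableSet D' :=
    MeasurableSet.biUnion (Set.to_countable S) (fun m _ => hm m hDm)
  have hsub : D ⊆ D' := fun x hx => by
    simp only [hD', Set.mem_iUnion, Set.mem_preimage]
    exact ⟨p, hpS, hfwd p hpS x hx⟩
  have hDD : μ D' = μ D := by
    have h0 : μ (D' \ D) = 0 := by
      have hs : D' \ D ⊆ ⋃ m ∈ S, ((fun x : AddCircle (1:ℝ) => m • x) ⁻¹' D) \ D := by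
        rintro x ⟨h1, h2⟩
        simp only [hD', Set.mem_iUnion] at h1 ⊢
        obtain ⟨m, hmS, h⟩ := h1
        exact ⟨m, hmS, h, h2⟩
      refine measure_mono_null hs ?_
      rw [measure_biUnion_null_iff (Set.to_countable S)]
      intro m hmS
      have hs2 : D ⊆ (fun x : AddCircle (1:ℝ) => m • x) ⁻¹' D := fun x hx => hfwd m hmS x hx
      rw [measure_sdiff hs2 hDm.nullMeasurableSet (measure_ne_top _ _),
        hinv m hmS D hDm, tsub_self]
    apply le_antisymm _ (measure_mono hsub)
    calc μ D' ≤ μ (D ∪ D' \ D) := measure_mono (by intro x hx; by_cases h : x ∈ D <;> simp [h, hx])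
      _ ≤ _ := measure_union_le _ _
      _ = μ D := by rw [h0, add_zero]
  have := herg D' hD'm (by
    intro n hn
    ext x
    simp only [hD', Set.mem_preimage, Set.mem_iUnion]
    constructor
    · rintro ⟨m, hmS, h⟩
      exact ⟨m * n, hS m hmS n hn, by rwa [mul_smul]⟩
    · rintro ⟨m, hmS, h⟩
      exact ⟨m, hmS, by rw [smul_comm]; exact hfwd n hn _ h⟩)
  rw [hDD] at this
  rcases this with h | h
  · exfalso
    have : μ {r} ≤ μ D := measure_mono (by simp [hD])
    rw [h] at this
    exact absurd hr (not_lt.mpr this)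
  · exact h

lemma torsion_of_approx (p : ℕ) (hp : 2 ≤ p) (x : ℝ) (t0 : ℕ) (k : ℕ → ℕ)
    (hk0 : ∀ t ≥ t0, 1 ≤ k t) (hk1 : ∀ t ≥ t0, k t ≤ p ^ t)
    (hk : ∀ t ≥ t0, ‖(k t) • (x : AddCircle (1:ℝ))‖ ≤ 2 * (p:ℝ) ^ t / (p:ℝ) ^ (8 * t)) :
    ∃ q : ℚ, x = q := by
  have hpR : (2:ℝ) ≤ p := by exact_mod_cast hp
  wlog h3 : 3 ≤ t0 generalizing t0
  · exact this (max t0 3) (fun t ht => hk0 t (le_trans (le_max_left _ _) ht))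
      (fun t ht => hk1 t (le_trans (le_max_left _ _) ht))
      (fun t ht => hk t (le_trans (le_max_left _ _) ht)) (le_max_right _ _)
  set a : ℕ → ℤ := fun t => round ((k t : ℝ) * x) with ha
  have he : ∀ t ≥ t0, |(k t : ℝ) * x - a t| * (p:ℝ) ^ (7 * t) ≤ 2 := by
    intro t ht
    have h := hk t ht
    have h1 : (k t) • (x : AddCircle (1:ℝ)) = (((k t : ℝ) * x : ℝ) : AddCircle (1:ℝ)) := by
      rw [← AddCircle.coe_nsmul, nsmul_eq_mul]
    rw [h1, UnitAddCircle.norm_eq] at h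
    have hpp : (0:ℝ) < (p:ℝ)^t := by positivity
    rw [le_div_iff₀ (by positivity)] at h
    have h2 : (p:ℝ)^(8*t) = (p:ℝ)^(7*t) * (p:ℝ)^t := by rw [← pow_add]; congr 1; ring
    rw [h2, ← mul_assoc] at h
    exact le_of_mul_le_mul_right h hpp
  have hstep : ∀ t ≥ t0, (k (t+1) : ℤ) * a t = k t * a (t+1) := by
    intro t ht
    have h1 := he t ht
    have h2 := he (t+1) (by omega)
    have hk2 : (k (t+1) : ℝ) ≤ (p:ℝ)^(t+1) := by exact_mod_cast hk1 (t+1) (by omega)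
    have hk3 : (k t : ℝ) ≤ (p:ℝ)^t := by exact_mod_cast hk1 t ht
    have hpt : (8:ℝ) ≤ (p:ℝ)^t := by
      calc (8:ℝ) = 2^3 := by norm_num
        _ ≤ 2^t := pow_le_pow_right₀ (by norm_num) (by omega)
        _ ≤ (p:ℝ)^t := pow_le_pow_left₀ (by norm_num) hpR t
    have hpt' : (p:ℝ) ≤ (p:ℝ)^t := le_self_pow₀ (by linarith) (by omega)
    have hb1 : |(k t : ℝ) * x - a t| * k (t+1) ≤ 1/4 := by
      have e : (p:ℝ)^(7*t) = (p:ℝ)^t * (p:ℝ)^t * (p:ℝ)^(5*t) := by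
        rw [← pow_add, ← pow_add]; congr 1; ring
      have h5 : (8:ℝ) ≤ (p:ℝ)^(5*t) := hpt.trans (pow_le_pow_right₀ (by linarith) (by omega))
      have h6 : (k (t+1) : ℝ) * 8 ≤ (p:ℝ)^(7*t) := by
        rw [e]
        rw [pow_succ] at hk2
        have : (p:ℝ)^t * p ≤ (p:ℝ)^t * (p:ℝ)^t := by gcongr
        have : (k (t+1) : ℝ) ≤ (p:ℝ)^t * (p:ℝ)^t := by linarith
        gcongr
      have := mul_le_mul_of_nonneg_left h6 (abs_nonneg ((k t : ℝ) * x - a t))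
      linarith
    have hb2 : |(k (t+1) : ℝ) * x - a (t+1)| * k t ≤ 1/4 := by
      have e : (p:ℝ)^(7*(t+1)) = (p:ℝ)^t * (p:ℝ)^(6*t+7) := by
        rw [← pow_add]; congr 1; ring
      have h5 : (8:ℝ) ≤ (p:ℝ)^(6*t+7) := hpt.trans (pow_le_pow_right₀ (by linarith) (by omega))
      have h6 : (k t : ℝ) * 8 ≤ (p:ℝ)^(7*(t+1)) := by
        rw [e]; gcongr
      have := mul_le_mul_of_nonneg_left h6 (abs_nonneg ((k (t+1) : ℝ) * x - a (t+1)))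
      linarith
    have hlt : |((k (t+1) : ℤ) * a t - k t * a (t+1) : ℤ)| < 1 := by
      have : |(((k (t+1) : ℤ) * a t - k t * a (t+1) : ℤ) : ℝ)| < 1 := by
        push_cast
        have : (k (t+1) : ℝ) * a t - k t * a (t+1) =
          ((k (t+1) : ℝ) * x - a (t+1)) * k t - ((k t : ℝ) * x - a t) * k (t+1) := by ring
        rw [this]
        refine (abs_sub _ _).trans_lt ?_
        rw [abs_mul, abs_mul, Nat.abs_cast, Nat.abs_cast]
        linarith
      exact_mod_cast this
    have := Int.abs_lt_one_iff.mp hlt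
    linarith
  have hq : ∀ t ≥ t0, (a t : ℚ) / k t = a t0 / k t0 := by
    intro t ht
    induction t, ht using Nat.le_induction with
    | base => rfl
    | succ t ht ih =>
      rw [← ih]
      have h1 := hk0 t ht
      have h2 := hk0 (t+1) (by omega)
      have h3 : (k t : ℚ) ≠ 0 := by positivity
      have h4 : (k (t+1) : ℚ) ≠ 0 := by positivity
      rw [div_eq_div_iff h4 h3]
      have := hstep t ht
      have h5 : ((k (t+1) : ℤ) * a t : ℚ) = (k t * a (t+1) : ℚ) := by exact_mod_cast this
      push_cast at h5
      linarith
  refine ⟨(a t0 : ℚ) / k t0, ?_⟩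
  have hlim : ∀ t ≥ t0, |x - (((a t0 : ℚ) / k t0 : ℚ) : ℝ)| ≤ 2 * (1/2:ℝ)^t := by
    intro t ht
    rw [← hq t ht]
    have h1 := hk0 t ht
    have h1' : (1:ℝ) ≤ k t := by exact_mod_cast h1
    push_cast
    have : x - (a t : ℝ) / k t = ((k t : ℝ) * x - a t) / k t := by field_simp
    rw [this, abs_div, Nat.abs_cast]
    have h2 := he t ht
    have h3 : (2:ℝ)^t ≤ (p:ℝ)^(7*t) :=
      (pow_le_pow_left₀ (by norm_num) hpR t).trans (pow_le_pow_right₀ (by linarith) (by omega))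
    have h4 := mul_le_mul_of_nonneg_left h3 (abs_nonneg ((k t : ℝ) * x - a t))
    calc _ ≤ |(k t : ℝ) * x - a t| := div_le_self (abs_nonneg _) h1'
      _ ≤ _ := by
        rw [one_div, inv_pow, ← div_eq_mul_inv, le_div_iff₀ (by positivity)]
        linarith
  have hz : |x - (((a t0 : ℚ) / k t0 : ℚ) : ℝ)| ≤ 0 := by
    have : Tendsto (fun t : ℕ => 2 * (1/2:ℝ)^t) atTop (nhds (2 * 0)) :=
      (tendsto_pow_atTop_nhds_zero_of_lt_one (by norm_num) (by norm_num)).const_mul 2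
    rw [mul_zero] at this
    exact ge_of_tendsto this (eventually_atTop.mpr ⟨t0, hlim⟩)
  have := abs_nonpos_iff.mp hz
  linarith

/-- Representative in `(0,1]`. -/
noncomputable def rep (x : AddCircle (1:ℝ)) : ℝ := (AddCircle.equivIoc 1 0 x : ℝ)

lemma rep_pos (x : AddCircle (1:ℝ)) : 0 < rep x := (AddCircle.equivIoc (1:ℝ) 0 x).2.1

lemma rep_le (x : AddCircle (1:ℝ)) : rep x ≤ 1 := by
  have := (AddCircle.equivIoc (1:ℝ) 0 x).2.2
  simpa [rep] using this

lemma coe_rep (x : AddCircle (1:ℝ)) : ((rep x : ℝ) : AddCircle (1:ℝ)) = x :=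
  AddCircle.coe_equivIoc

lemma rep_eq (u : ℝ) (h0 : 0 < u) (h1 : u ≤ 1) : rep (u : AddCircle (1:ℝ)) = u := by
  have h : u ∈ Set.Ioc (0:ℝ) (0+1) := ⟨h0, by linarith⟩
  exact AddCircle.equivIoc_coe_of_mem h

lemma rep_measurable : Measurable rep :=
  measurable_subtype_coe.comp (AddCircle.measurableEquivIoc (1:ℝ) 0).measurable

/-- Index of the level `n` arc that contains `x`. -/
noncomputable def idx (p n : ℕ) (x : AddCircle (1:ℝ)) : ℕ := ⌈rep x * (p:ℝ) ^ n⌉₊ - 1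

lemma idx_measurable (p n : ℕ) : Measurable (idx p n) := by
  have h : Measurable (fun k : ℕ => k - 1) := measurable_from_top
  exact h.comp (Nat.measurable_ceil.comp (rep_measurable.mul_const _))

lemma idx_iff (p n : ℕ) (hp : 2 ≤ p) (x : AddCircle (1:ℝ)) (k : ℕ) :
    idx p n x = k ↔ (k:ℝ) < rep x * (p:ℝ)^n ∧ rep x * (p:ℝ)^n ≤ k + 1 := by
  have hpos : 0 < rep x * (p:ℝ)^n := mul_pos (rep_pos x) (by positivity)
  have h1 : 1 ≤ ⌈rep x * (p:ℝ) ^ n⌉₊ := Nat.one_le_ceil_iff.mpr hpos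
  have h2 : idx p n x = k ↔ ⌈rep x * (p:ℝ) ^ n⌉₊ = k + 1 := by
    unfold idx; omega
  rw [h2, Nat.ceil_eq_iff (by omega)]
  simp

lemma idx_spec (p n : ℕ) (hp : 2 ≤ p) (x : AddCircle (1:ℝ)) :
    ((idx p n x : ℕ):ℝ) < rep x * (p:ℝ)^n ∧ rep x * (p:ℝ)^n ≤ idx p n x + 1 :=
  (idx_iff p n hp x _).mp rfl

lemma idx_lt (p n : ℕ) (hp : 2 ≤ p) (x : AddCircle (1:ℝ)) : idx p n x < p ^ n := by
  have h := (idx_spec p n hp x).1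
  have h1 : rep x * (p:ℝ)^n ≤ 1 * (p:ℝ)^n := by gcongr; exact rep_le x
  have : ((idx p n x : ℕ):ℝ) < ((p^n : ℕ) : ℝ) := by push_cast; linarith
  exact_mod_cast this

lemma idx_preimage (p n : ℕ) (hp : 2 ≤ p) (k : ℕ) (hk : k < p ^ n) :
    idx p n ⁻¹' {k} = arc ((k : ℝ) / (p : ℝ) ^ n) (((k : ℝ) + 1) / (p : ℝ) ^ n) := by
  have hpp : (0:ℝ) < (p:ℝ)^n := by positivity
  ext x
  rw [Set.mem_preimage, Set.mem_singleton_iff, idx_iff p n hp]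
  unfold arc
  constructor
  · rintro ⟨h1, h2⟩
    exact ⟨rep x, ⟨by rwa [div_lt_iff₀ hpp], by rwa [le_div_iff₀ hpp]⟩, coe_rep x⟩
  · rintro ⟨u, ⟨h1, h2⟩, rfl⟩
    have h0 : 0 < u := lt_of_le_of_lt (by positivity) h1
    have hk' : (k:ℝ) + 1 ≤ (p:ℝ)^n := by exact_mod_cast hk
    have h3 : u ≤ 1 := h2.trans (by rwa [div_le_one hpp])
    simp only [rep_eq u h0 h3]
    exact ⟨by rwa [div_lt_iff₀ hpp] at h1, by rwa [le_div_iff₀ hpp] at h2⟩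

lemma idx_div (p n m : ℕ) (hp : 2 ≤ p) (x : AddCircle (1:ℝ)) :
    idx p (n + m) x / p ^ m = idx p n x := by
  symm
  rw [idx_iff p n hp]
  obtain ⟨h1, h2⟩ := idx_spec p (n+m) hp x
  set K := idx p (n+m) x
  have hpm : (0:ℝ) < (p:ℝ)^m := by positivity
  have hpm' : 0 < p^m := by positivity
  rw [pow_add, ← mul_assoc] at h1 h2
  have e1 : ((K / p^m : ℕ):ℝ) * (p:ℝ)^m ≤ K := by exact_mod_cast Nat.div_mul_le_self K (p^m)
  have e2 : (K:ℝ) + 1 ≤ (((K / p^m : ℕ):ℝ) + 1) * (p:ℝ)^m := by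
    have : K + 1 ≤ (K / p^m + 1) * p^m := by
      have := Nat.lt_div_mul_add hpm' (a := K)
      rw [add_mul, one_mul]; omega
    exact_mod_cast this
  constructor
  · exact lt_of_mul_lt_mul_right (e1.trans_lt h1) hpm.le
  · exact le_of_mul_le_mul_right (h2.trans e2) hpm

lemma rep_smul (p : ℕ) (hp : 2 ≤ p) (x : AddCircle (1:ℝ)) :
    rep (p • x) = rep x * p - idx p 1 x := by
  obtain ⟨h1, h2⟩ := idx_spec p 1 hp x
  rw [pow_one] at h1 h2
  have : p • x = ((rep x * p - idx p 1 x : ℝ) : AddCircle (1:ℝ)) := by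
    conv_lhs => rw [← coe_rep x, ← AddCircle.coe_nsmul]
    have hz : (((idx p 1 x : ℕ) : ℝ) : AddCircle (1:ℝ)) = 0 := by
      have := AddCircle.coe_nsmul (p := (1:ℝ)) (n := idx p 1 x) (x := (1:ℝ))
      rw [AddCircle.coe_period, smul_zero, nsmul_eq_mul, mul_one] at this
      exact this
    rw [AddCircle.coe_sub, hz, sub_zero, nsmul_eq_mul, mul_comm]
  rw [this, rep_eq _ (by linarith) (by linarith)]

lemma idx_mod (p n : ℕ) (hp : 2 ≤ p) (x : AddCircle (1:ℝ)) :
    idx p n (p • x) = idx p (n + 1) x % p ^ n := by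
  rw [idx_iff p n hp, rep_smul p hp]
  have hd := idx_div p 1 n hp x
  rw [add_comm 1 n] at hd
  obtain ⟨h1, h2⟩ := idx_spec p (n+1) hp x
  rw [← hd]
  set K := idx p (n+1) x
  have e : (K:ℝ) = (p:ℝ)^n * ((K / p^n : ℕ):ℝ) + ((K % p^n : ℕ) : ℝ) := by
    exact_mod_cast (Nat.div_add_mod K (p^n)).symm
  rw [pow_succ] at h1 h2
  constructor
  · nlinarith
  · nlinarith

lemma sum_range_mul_split (p m : ℕ) (f : ℕ → ℝ) :
    ∑ k ∈ Finset.range (p * m), f k =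
      ∑ j ∈ Finset.range m, ∑ d ∈ Finset.range p, f (d * m + j) := by
  rw [Finset.sum_comm]
  induction p with
  | zero => simp
  | succ p ih => rw [add_mul, one_mul, Finset.sum_range_add, ih, Finset.sum_range_succ]

/-- Weights of words. -/
noncomputable def wgt (q : ℕ → ℝ) (p N : ℕ) : ℕ → ℕ → ℝ
  | 0 => fun _ => 1
  | (n+1) => fun k => q (k / p ^ n) * wgt q p N n (k % p ^ (n + N))

lemma wgt_nonneg (q : ℕ → ℝ) (p N : ℕ) (hq : ∀ k, 0 ≤ q k) (n : ℕ) : ∀ k, 0 ≤ wgt q p N n k := by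
  induction n with
  | zero => intro k; simp [wgt]
  | succ n ih => intro k; exact mul_nonneg (hq _) (ih _)

lemma wgt_sum (q : ℕ → ℝ) (p N : ℕ) (hp : 2 ≤ p) (hq : ∀ k, 0 ≤ q k)
    (hs : ∀ j < p ^ N, ∑ d ∈ Finset.range p, q (d * p ^ N + j) ≤ 1) (n : ℕ) :
    ∑ k ∈ Finset.range (p ^ (n + N)), wgt q p N n k ≤ (p:ℝ) ^ N := by
  induction n with
  | zero => simp [wgt]
  | succ n ih =>
    have e : p ^ (n + 1 + N) = p * p ^ (n + N) := by ring
    rw [e, sum_range_mul_split]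
    refine le_trans (Finset.sum_le_sum ?_) ih
    intro j hj
    rw [Finset.mem_range] at hj
    have hpn : 0 < p ^ n := by positivity
    have h1 : ∀ d ∈ Finset.range p, wgt q p N (n+1) (d * p ^ (n+N) + j) =
        q (d * p ^ N + j / p ^ n) * wgt q p N n j := by
      intro d _
      change q ((d * p ^ (n+N) + j) / p ^ n) * wgt q p N n ((d * p ^ (n+N) + j) % p ^ (n + N)) = _
      congr 2
      · rw [pow_add, mul_comm (p^n), ← mul_assoc, add_comm, Nat.add_mul_div_right _ _ hpn, add_comm]
      · rw [add_comm, Nat.add_mul_mod_self_right, Nat.mod_eq_of_lt hj]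
    rw [Finset.sum_congr rfl h1, ← Finset.sum_mul]
    have h2 : j / p ^ n < p ^ N := by
      rw [Nat.div_lt_iff_lt_mul hpn]; rwa [add_comm, pow_add] at hj
    have h3 := hs _ h2
    have h4 := wgt_nonneg q p N hq n j
    nlinarith

lemma wgt_idx (q : ℕ → ℝ) (p N : ℕ) (hp : 2 ≤ p) (n : ℕ) : ∀ x : AddCircle (1:ℝ),
    wgt q p N n (idx p (n + N) x) =
      ∏ j ∈ Finset.range n, q (idx p (N+1) ((fun y : AddCircle (1:ℝ) => p • y)^[j] x)) := by
  induction n with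
  | zero => intro x; simp [wgt]
  | succ n ih =>
    intro x
    rw [Finset.prod_range_succ']
    change q (idx p (n + 1 + N) x / p ^ n) * wgt q p N n (idx p (n + 1 + N) x % p ^ (n + N)) = _
    have h1 : idx p (n + 1 + N) x / p ^ n = idx p (N+1) x := by
      rw [← idx_div p (N+1) n hp x]; congr 2; ring
    have h2 : idx p (n + 1 + N) x % p ^ (n+N) = idx p (n+N) (p • x) := by
      rw [idx_mod p (n+N) hp x]; congr 2; ring
    rw [h1, h2, ih (p • x)]
    simp only [Function.iterate_succ, Function.comp_apply, Function.iterate_zero, id]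
    ring

/-- Mass of the `k`-th arc of level `n`. -/
noncomputable def mass (μ : Measure (AddCircle (1:ℝ))) (p n k : ℕ) : ℝ := μ.real (idx p n ⁻¹' {k})

lemma mass_nonneg (μ : Measure (AddCircle (1:ℝ))) (p n k : ℕ) : 0 ≤ mass μ p n k :=
  measureReal_nonneg

lemma mass_sum (μ : Measure (AddCircle (1:ℝ))) [IsProbabilityMeasure μ] (p n : ℕ) (hp : 2 ≤ p) :
    ∑ k ∈ Finset.range (p ^ n), mass μ p n k = 1 := by
  unfold mass
  rw [sum_measureReal_preimage_singleton _
    (fun y _ => idx_measurable p n (MeasurableSet.singleton y))]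
  have : idx p n ⁻¹' (↑(Finset.range (p ^ n)) : Set ℕ) = Set.univ := by
    ext x; simp [idx_lt p n hp x]
  rw [this]; simp

lemma mass_rec (μ : Measure (AddCircle (1:ℝ))) [IsProbabilityMeasure μ] (p n : ℕ) (hp : 2 ≤ p)
    (hT : MeasurePreserving (fun x : AddCircle (1:ℝ) => p • x) μ μ) (j : ℕ) (hj : j < p ^ n) :
    ∑ d ∈ Finset.range p, mass μ p (n+1) (d * p ^ n + j) = mass μ p n j := by
  unfold mass
  have hpn : 0 < p ^ n := by positivity
  rw [← hT.measureReal_preimage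
    (idx_measurable p n (MeasurableSet.singleton j)).nullMeasurableSet]
  have hinj : Set.InjOn (fun d => d * p ^ n + j) (Finset.range p : Set ℕ) := by
    intro a _ b _ hab
    simp only [Nat.add_right_cancel_iff] at hab
    exact Nat.eq_of_mul_eq_mul_right hpn hab
  rw [← Finset.sum_image (f := fun k => μ.real (idx p (n+1) ⁻¹' {k})) hinj,
    sum_measureReal_preimage_singleton _
    (fun y _ => idx_measurable p (n+1) (MeasurableSet.singleton y))]
  congr 1
  ext x
  simp only [Finset.coe_image, Set.mem_preimage, Set.mem_image, Finset.coe_range, Set.mem_Iio,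
    Set.mem_singleton_iff]
  rw [idx_mod p n hp]
  have hlt := idx_lt p (n+1) hp x
  constructor
  · rintro ⟨d, hd, h⟩
    rw [← h, add_comm, Nat.add_mul_mod_self_right, Nat.mod_eq_of_lt hj]
  · intro h
    refine ⟨idx p (n+1) x / p^n, ?_, ?_⟩
    · rw [Nat.div_lt_iff_lt_mul hpn]; rwa [pow_succ, mul_comm] at hlt
    · rw [← h]; exact Nat.div_add_mod' _ _

lemma mass_le (μ : Measure (AddCircle (1:ℝ))) [IsProbabilityMeasure μ] (p n : ℕ) (hp : 2 ≤ p)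
    (hT : MeasurePreserving (fun x : AddCircle (1:ℝ) => p • x) μ μ) (j : ℕ) (hj : j < p ^ n)
    (d : ℕ) (hd : d < p) :
    mass μ p (n+1) (d * p ^ n + j) ≤ mass μ p n j := by
  rw [← mass_rec μ p n hp hT j hj]
  exact Finset.single_le_sum (f := fun d => mass μ p (n+1) (d * p ^ n + j))
    (fun i _ => mass_nonneg μ p (n+1) _) (Finset.mem_range.mpr hd)

/-- Entropy of the level `n` partition. -/
noncomputable def ent (μ : Measure (AddCircle (1:ℝ))) (p n : ℕ) : ℝ :=
  ∑ k ∈ Finset.range (p ^ n), Real.negMulLog (mass μ p n k)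

/-- Conditional mass. -/
noncomputable def cm (μ : Measure (AddCircle (1:ℝ))) (p N k : ℕ) : ℝ :=
  mass μ p (N+1) k / mass μ p N (k % p ^ N)

lemma cm_nonneg (μ : Measure (AddCircle (1:ℝ))) (p N k : ℕ) : 0 ≤ cm μ p N k :=
  div_nonneg (mass_nonneg _ _ _ _) (mass_nonneg _ _ _ _)

lemma cm_eq (μ : Measure (AddCircle (1:ℝ))) (p N d j : ℕ) (hj : j < p ^ N) :
    cm μ p N (d * p ^ N + j) = mass μ p (N+1) (d * p ^ N + j) / mass μ p N j := by
  unfold cm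
  rw [add_comm (d * p ^ N) j, Nat.add_mul_mod_self_right, Nat.mod_eq_of_lt hj]

lemma cm_sum (μ : Measure (AddCircle (1:ℝ))) [IsProbabilityMeasure μ] (p N : ℕ) (hp : 2 ≤ p)
    (hT : MeasurePreserving (fun x : AddCircle (1:ℝ) => p • x) μ μ) (j : ℕ) (hj : j < p ^ N) :
    ∑ d ∈ Finset.range p, cm μ p N (d * p ^ N + j) ≤ 1 := by
  rw [Finset.sum_congr rfl (fun d _ => cm_eq μ p N d j hj), ← Finset.sum_div,
    mass_rec μ p N hp hT j hj]
  exact div_self_le_one _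

lemma cm_le_one (μ : Measure (AddCircle (1:ℝ))) [IsProbabilityMeasure μ] (p N : ℕ) (hp : 2 ≤ p)
    (hT : MeasurePreserving (fun x : AddCircle (1:ℝ) => p • x) μ μ) (k : ℕ) (hk : k < p ^ (N+1)) :
    cm μ p N k ≤ 1 := by
  have hpn : 0 < p ^ N := by positivity
  have h1 : k / p ^ N < p := by
    rw [Nat.div_lt_iff_lt_mul hpn]; rwa [pow_succ, mul_comm] at hk
  have h := mass_le μ p N hp hT (k % p^N) (Nat.mod_lt _ hpn) (k / p^N) h1
  rw [Nat.div_add_mod'] at h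
  exact div_le_one_of_le₀ h (mass_nonneg _ _ _ _)

lemma ent_diff (μ : Measure (AddCircle (1:ℝ))) [IsProbabilityMeasure μ] (p N : ℕ) (hp : 2 ≤ p)
    (hT : MeasurePreserving (fun x : AddCircle (1:ℝ) => p • x) μ μ) :
    ∑ k ∈ Finset.range (p ^ (N+1)), mass μ p (N+1) k * (-Real.log (cm μ p N k)) =
      ent μ p (N+1) - ent μ p N := by
  unfold ent
  have e : p ^ (N+1) = p * p ^ N := by ring
  rw [e, sum_range_mul_split, sum_range_mul_split, ← Finset.sum_sub_distrib]
  apply Finset.sum_congr rfl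
  intro j hj
  rw [Finset.mem_range] at hj
  have h1 : ∀ d ∈ Finset.range p, mass μ p (N+1) (d * p ^ N + j) *
      (-Real.log (cm μ p N (d * p ^ N + j))) =
      Real.negMulLog (mass μ p (N+1) (d * p ^ N + j)) +
        mass μ p (N+1) (d * p ^ N + j) * Real.log (mass μ p N j) := by
    intro d hd
    rw [cm_eq μ p N d j hj]
    have h2 := mass_le μ p N hp hT j hj d (Finset.mem_range.mp hd)
    have h3 := mass_nonneg μ p (N+1) (d * p ^ N + j)
    rcases h3.eq_or_lt with h | h
    · rw [← h]; simp
    · rw [Real.log_div h.ne' (by linarith), Real.negMulLog]; ring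
  rw [Finset.sum_congr rfl h1, Finset.sum_add_distrib, ← Finset.sum_mul,
    mass_rec μ p N hp hT j hj, Real.negMulLog]
  ring

lemma ent_le (μ : Measure (AddCircle (1:ℝ))) [IsProbabilityMeasure μ] (p n : ℕ) (hp : 2 ≤ p) :
    ent μ p n ≤ n * Real.log p := by
  unfold ent
  have hP : (0:ℝ) < (p:ℝ)^n := by positivity
  have h1 : ∀ k ∈ Finset.range (p^n), Real.negMulLog (mass μ p n k) ≤
      1 / (p:ℝ)^n - mass μ p n k + mass μ p n k * (n * Real.log p) := by
    intro k _
    have h3 := mass_nonneg μ p n k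
    rcases h3.eq_or_lt with h | h
    · rw [← h]; simp
    · have h4 := Real.log_le_sub_one_of_pos (x := 1 / (mass μ p n k * (p:ℝ)^n)) (by positivity)
      rw [one_div, Real.log_inv, Real.log_mul h.ne' hP.ne', Real.log_pow] at h4
      have h5 := mul_le_mul_of_nonneg_left h4 h3
      have h6 : mass μ p n k * ((mass μ p n k * (p:ℝ)^n)⁻¹ - 1) = 1 / (p:ℝ)^n - mass μ p n k := by
        field_simp
      rw [h6] at h5
      rw [Real.negMulLog]
      linarith
  refine (Finset.sum_le_sum h1).trans ?_
  rw [Finset.sum_add_distrib, Finset.sum_sub_distrib, ← Finset.sum_mul, mass_sum μ p n hp]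
  simp [hP.ne']

lemma exists_small_diff (μ : Measure (AddCircle (1:ℝ))) [IsProbabilityMeasure μ] (p : ℕ)
    (hp : 2 ≤ p) (hent : padicEntropy p μ = 0) (η : ℝ) (hη : 0 < η) :
    ∃ N, ent μ p (N+1) - ent μ p N < η := by
  by_contra! hcon
  have h0 : ∀ n : ℕ, n * η ≤ ent μ p n := by
    intro n
    induction n with
    | zero =>
      simp only [Nat.cast_zero, zero_mul, ent]
      apply Finset.sum_nonneg
      intro k _
      exact Real.negMulLog_nonneg (mass_nonneg _ _ _ _) measureReal_le_one
    | succ n ih => have := hcon n; push_cast; linarith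
  have hE : padicEntropy p μ = atTop.limsup (fun n : ℕ => (1 / (n:ℝ)) * ent μ p n) := by
    unfold padicEntropy ent mass
    congr 1
    ext n
    congr 1
    apply Finset.sum_congr rfl
    intro k hk
    rw [idx_preimage p n hp k (Finset.mem_range.mp hk)]
    rfl
  have hle : η ≤ padicEntropy p μ := by
    rw [hE]
    apply le_limsup_of_frequently_le
    · apply Eventually.frequently
      filter_upwards [eventually_ge_atTop 1] with n hn
      have hn' : (0:ℝ) < n := by exact_mod_cast hn
      rw [one_div, ← div_eq_inv_mul, le_div_iff₀ hn', mul_comm]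
      exact h0 n
    · refine ⟨Real.log p, ?_⟩
      rw [eventually_map]
      filter_upwards [eventually_ge_atTop 1] with n hn
      have hn' : (0:ℝ) < n := by exact_mod_cast hn
      rw [one_div, ← div_eq_inv_mul, div_le_iff₀ hn', mul_comm]
      exact ent_le μ p n hp
  linarith

lemma integral_idx (μ : Measure (AddCircle (1:ℝ))) [IsProbabilityMeasure μ] (p n : ℕ)
    (hp : 2 ≤ p) (G : ℕ → ℝ) :
    Integrable (fun x => G (idx p n x)) μ ∧
    ∫ x, G (idx p n x) ∂μ = ∑ k ∈ Finset.range (p ^ n), mass μ p n k * G k := by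
  have hm : ∀ k, MeasurableSet (idx p n ⁻¹' {k}) :=
    fun k => idx_measurable p n (MeasurableSet.singleton k)
  have he : (fun x => G (idx p n x)) = fun x => ∑ k ∈ Finset.range (p ^ n),
      (idx p n ⁻¹' {k}).indicator (fun _ => G k) x := by
    ext x
    rw [Finset.sum_eq_single (idx p n x)]
    · rw [Set.indicator_of_mem (by simp)]
    · intro b _ hb
      exact Set.indicator_of_notMem (by simpa using hb.symm) _
    · intro h
      exact absurd (Finset.mem_range.mpr (idx_lt p n hp x)) h
  have hi : ∀ k ∈ Finset.range (p ^ n),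
      Integrable ((idx p n ⁻¹' {k}).indicator (fun _ => G k)) μ :=
    fun k _ => (integrable_const _).indicator (hm k)
  rw [he]
  refine ⟨integrable_finsetSum _ hi, ?_⟩
  rw [integral_finsetSum _ hi]
  apply Finset.sum_congr rfl
  intro k _
  rw [integral_indicator_const _ (hm k), smul_eq_mul]
  rfl

lemma mass_bad (μ : Measure (AddCircle (1:ℝ))) [IsProbabilityMeasure μ] (p n : ℕ)
    (hp : 2 ≤ p) (P : ℕ → Prop) [DecidablePred P] :
    μ.real {x | P (idx p n x)} = ∑ k ∈ (Finset.range (p ^ n)).filter P, mass μ p n k := by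
  unfold mass
  rw [sum_measureReal_preimage_singleton _
    (fun y _ => idx_measurable p n (MeasurableSet.singleton y))]
  congr 1
  ext x
  simp [idx_lt p n hp x]

lemma main_measure (μ : Measure (AddCircle (1:ℝ))) [IsProbabilityMeasure μ] (p : ℕ)
    (hp : 2 ≤ p) (hT : MeasurePreserving (fun x : AddCircle (1:ℝ) => p • x) μ μ)
    (hent : padicEntropy p μ = 0) (ε : ℝ) (hε : 0 < ε) :
    ∃ Y : Set (AddCircle (1:ℝ)), 0 < μ Y ∧ ∀ x ∈ Y, ∀ᶠ n : ℕ in atTop,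
      Real.exp (-(2 * ε * n)) ≤ mass μ p n (idx p n x) := by
  classical
  obtain ⟨N, hN⟩ := exists_small_diff μ p hp hent ε hε
  rw [← ent_diff μ p N hp hT] at hN
  obtain ⟨hgi, hgint⟩ := integral_idx μ p (N+1) hp (fun k => -Real.log (cm μ p N k))
  rw [← hgint] at hN
  have hGm : Measurable (fun x => -Real.log (cm μ p N (idx p (N+1) x))) :=
    (measurable_from_top (f := fun k => -Real.log (cm μ p N k))).comp (idx_measurable p (N+1))
  obtain ⟨Y, hY, hYs⟩ := maximal_ineq μ _ hT _ hGm hgi (fun x => by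
    have h1 := cm_le_one μ p N hp hT _ (idx_lt p (N+1) hp x)
    have := Real.log_nonpos (cm_nonneg μ p N (idx p (N+1) x)) h1
    linarith) ε hε hN
  -- positivity of the conditional mass
  have hpos0 : ∀ᵐ x ∂μ, 0 < cm μ p N (idx p (N+1) x) := by
    have h := mass_bad μ p (N+1) hp (fun k => ¬ 0 < cm μ p N k)
    rw [Finset.sum_eq_zero] at h
    · rw [measureReal_eq_zero_iff] at h
      exact h
    · intro k hk
      rw [Finset.mem_filter, Finset.mem_range] at hk
      obtain ⟨hk, hc⟩ := hk
      have hc0 : cm μ p N k = 0 := le_antisymm (not_lt.mp hc) (cm_nonneg _ _ _ _)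
      have hpn : 0 < p ^ N := by positivity
      have h1 : k / p ^ N < p := by
        rw [Nat.div_lt_iff_lt_mul hpn]; rwa [pow_succ, mul_comm] at hk
      have h := mass_le μ p N hp hT (k % p^N) (Nat.mod_lt _ hpn) (k / p^N) h1
      rw [Nat.div_add_mod'] at h
      rcases div_eq_zero_iff.mp hc0 with h2 | h2
      · exact h2
      · rw [h2] at h; exact le_antisymm h (mass_nonneg _ _ _ _)
  have hpos : ∀ᵐ x ∂μ, ∀ j : ℕ,
      0 < cm μ p N (idx p (N+1) ((fun y : AddCircle (1:ℝ) => p • y)^[j] x)) := by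
    rw [ae_all_iff]
    intro j
    exact (hT.iterate j).quasiMeasurePreserving.ae hpos0
  -- Borel-Cantelli
  set q := cm μ p N with hq
  set bad : ℕ → Set (AddCircle (1:ℝ)) := fun n =>
    {x | mass μ p (n+N) (idx p (n+N) x) < Real.exp (-(ε * n)) * wgt q p N n (idx p (n+N) x)}
    with hbad
  have hbadm : ∀ n, μ (bad n) ≤ ENNReal.ofReal ((p:ℝ)^N * (Real.exp (-ε))^n) := by
    intro n
    rw [← ofReal_measureReal]
    apply ENNReal.ofReal_le_ofReal
    rw [hbad]
    simp only
    rw [mass_bad μ p (n+N) hp (fun k => mass μ p (n+N) k < Real.exp (-(ε * n)) * wgt q p N n k)]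
    have hw := wgt_nonneg q p N (cm_nonneg μ p N) n
    calc _ ≤ ∑ k ∈ Finset.range (p ^ (n+N)) with
          mass μ p (n+N) k < Real.exp (-(ε * n)) * wgt q p N n k,
          Real.exp (-(ε * n)) * wgt q p N n k :=
          Finset.sum_le_sum (fun k hk => (Finset.mem_filter.mp hk).2.le)
      _ ≤ ∑ k ∈ Finset.range (p ^ (n+N)), Real.exp (-(ε * n)) * wgt q p N n k :=
          Finset.sum_le_sum_of_subset_of_nonneg (Finset.filter_subset _ _)
            (fun k _ _ => mul_nonneg (Real.exp_pos _).le (hw k))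
      _ ≤ Real.exp (-(ε * n)) * (p:ℝ)^N := by
          rw [← Finset.mul_sum]
          exact mul_le_mul_of_nonneg_left
            (wgt_sum q p N hp (cm_nonneg μ p N) (fun j hj => cm_sum μ p N hp hT j hj) n)
            (Real.exp_pos _).le
      _ = _ := by rw [← Real.exp_nat_mul, mul_comm]; congr 2; ring
  have hsum : ∑' n, μ (bad n) ≠ ⊤ := by
    have hs : Summable (fun n : ℕ => (p:ℝ)^N * (Real.exp (-ε))^n) :=
      (summable_geometric_of_lt_one (Real.exp_pos _).le
        (by rw [← Real.exp_zero]; exact Real.exp_lt_exp.mpr (by linarith))).mul_left _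
    exact ne_top_of_le_ne_top hs.tsum_ofReal_ne_top (ENNReal.tsum_le_tsum hbadm)
  have hBC := ae_eventually_notMem hsum
  have hgood : ∀ᵐ x ∂μ, (∀ j : ℕ,
      0 < cm μ p N (idx p (N+1) ((fun y : AddCircle (1:ℝ) => p • y)^[j] x))) ∧
      ∀ᶠ n in atTop, x ∉ bad n := hpos.and hBC
  refine ⟨Y ∩ {x | (∀ j : ℕ,
      0 < cm μ p N (idx p (N+1) ((fun y : AddCircle (1:ℝ) => p • y)^[j] x))) ∧
      ∀ᶠ n in atTop, x ∉ bad n}, ?_, ?_⟩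
  · rwa [measure_inter_conull hgood]
  · rintro x ⟨hxY, hx1, hx2⟩
    have h1 : ∀ᶠ n : ℕ in atTop,
        Real.exp (-(2 * ε * (n + N : ℕ))) ≤ mass μ p (n+N) (idx p (n+N) x) := by
      filter_upwards [hx2] with n hn
      simp only [hbad, Set.mem_ofPred_eq, not_lt] at hn
      refine le_trans ?_ hn
      rw [wgt_idx q p N hp]
      have h2 : ∏ j ∈ Finset.range n, q (idx p (N+1) ((fun y : AddCircle (1:ℝ) => p • y)^[j] x)) =
          Real.exp (-∑ j ∈ Finset.range n,
            -Real.log (cm μ p N (idx p (N+1) ((fun y : AddCircle (1:ℝ) => p • y)^[j] x)))) := by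
        rw [Finset.sum_neg_distrib, neg_neg, Real.exp_sum]
        exact Finset.prod_congr rfl (fun j _ => (Real.exp_log (hx1 j)).symm)
      rw [h2, ← Real.exp_add]
      apply Real.exp_le_exp.mpr
      have h3 := hYs x hxY n
      push_cast
      have : 0 ≤ ε * N := by positivity
      linarith
    obtain ⟨n0, hn0⟩ := eventually_atTop.mp h1
    refine eventually_atTop.mpr ⟨n0 + N, fun n hn => ?_⟩
    have h4 := hn0 (n - N) (by omega)
    rwa [Nat.sub_add_cancel (by omega)] at h4

lemma arc_ball (p n : ℕ) (hp : 2 ≤ p) (x : AddCircle (1:ℝ)) :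
    idx p n ⁻¹' {idx p n x} ⊆ Metric.closedBall x (1 / (p:ℝ)^n) := by
  intro y hy
  have hy : idx p n y = idx p n x := hy
  obtain ⟨h1, h2⟩ := idx_spec p n hp x
  obtain ⟨h3, h4⟩ := idx_spec p n hp y
  rw [hy] at h3 h4
  have hP : (0:ℝ) < (p:ℝ)^n := by positivity
  rw [Metric.mem_closedBall, dist_eq_norm, ← coe_rep x, ← coe_rep y, ← AddCircle.coe_sub]
  have h5 : ‖((rep y - rep x : ℝ) : AddCircle (1:ℝ))‖ ≤ |rep y - rep x| := by
    rw [UnitAddCircle.norm_eq]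
    have := round_le (rep y - rep x) 0
    simpa using this
  refine h5.trans ?_
  rw [le_div_iff₀ hP, ← abs_of_pos hP, ← abs_mul, abs_le]
  constructor <;> nlinarith

theorem stmt7 (α : ℝ) (hα : 0 < α) (S : Set ℕ) (hS : ∀ a ∈ S, ∀ b ∈ S, a * b ∈ S)
    (hgrowth : 0 < atTop.liminf
      (fun N : ℕ => ((S ∩ Set.Icc 1 N).ncard : ℝ) / (N : ℝ) ^ α))
    (μ : Measure (AddCircle (1:ℝ))) [IsProbabilityMeasure μ]
    (hinv : ∀ n ∈ S, ∀ A : Set (AddCircle (1:ℝ)), MeasurableSet A →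
      μ ((fun x : AddCircle (1:ℝ) => n • x) ⁻¹' A) = μ A)
    (herg : ∀ A : Set (AddCircle (1:ℝ)), MeasurableSet A →
      (∀ n ∈ S, (fun x : AddCircle (1:ℝ) => n • x) ⁻¹' A = A) → μ A = 0 ∨ μ A = 1)
    (p : ℕ) (hpS : p ∈ S) (hp : 2 ≤ p) (hent : padicEntropy p μ = 0) :
    ∃ F : Set (AddCircle (1:ℝ)), F.Finite ∧ μ F = 1 := by
  have hm : ∀ n : ℕ, Measurable (fun x : AddCircle (1:ℝ) => n • x) :=
    fun n => (continuous_nsmul n).measurable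
  have hT : MeasurePreserving (fun x : AddCircle (1:ℝ) => p • x) μ μ :=
    ⟨hm p, Measure.ext fun A hA => by rw [Measure.map_apply (hm p) hA, hinv p hpS A hA]⟩
  have hpR : (2:ℝ) ≤ p := by exact_mod_cast hp
  have hlp : 0 < Real.log p := Real.log_pos (by linarith)
  obtain ⟨c, hc0, hc⟩ : ∃ c : ℝ, 0 < c ∧ ∀ᶠ N : ℕ in atTop,
      c ≤ ((S ∩ Set.Icc 1 N).ncard : ℝ) / (N : ℝ) ^ α := by
    refine ⟨_, half_pos hgrowth, ?_⟩
    refine (eventually_lt_of_lt_liminf (half_lt_self hgrowth) ?_).mono fun _ h => h.le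
    refine ⟨0, ?_⟩
    rw [eventually_map]
    exact Eventually.of_forall fun n => by positivity
  obtain ⟨Y, hY, hYs⟩ := main_measure μ p hp hT hent (α * Real.log p / 32) (by positivity)
  -- every point of Y is rational
  have hrat : ∀ x ∈ Y, ∃ r : ℚ, x = ((r : ℝ) : AddCircle (1:ℝ)) := by
    intro x hx
    have hpow : Tendsto (fun t : ℕ => p ^ t) atTop atTop := tendsto_pow_atTop_atTop_of_one_lt hp
    have hmul : Tendsto (fun t : ℕ => 8 * t) atTop atTop :=
      tendsto_id.const_mul_atTop' (by norm_num)
    have hbig : ∀ᶠ t : ℕ in atTop, 1 < c * Real.exp (α * Real.log p / 2 * t) := by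
      have h1 : Tendsto (fun t : ℕ => c * Real.exp (α * Real.log p / 2 * t)) atTop atTop :=
        (Real.tendsto_exp_atTop.comp
          (tendsto_natCast_atTop_atTop.const_mul_atTop (by positivity))).const_mul_atTop hc0
      exact h1.eventually_gt_atTop 1
    have hex : ∀ᶠ t : ℕ in atTop, ∃ k : ℕ, 1 ≤ k ∧ k ≤ p ^ t ∧
        ‖k • x‖ ≤ 2 * (p:ℝ) ^ t / (p:ℝ) ^ (8 * t) := by
      filter_upwards [hpow.eventually hc, hmul.eventually (hYs x hx), hbig] with t h1 h2 h3
      set M := p ^ t with hM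
      have hfin : (S ∩ Set.Icc 1 M).Finite := (Set.finite_Icc 1 M).subset Set.inter_subset_right
      set Φ := hfin.toFinset with hΦ
      have hcard : (S ∩ Set.Icc 1 M).ncard = Φ.card := Set.ncard_eq_toFinset_card _ hfin
      have hMα : ((M:ℕ):ℝ) ^ α = Real.exp (α * Real.log p * t) := by
        rw [hM, Nat.cast_pow, ← Real.rpow_natCast, ← Real.rpow_mul (by positivity),
          Real.rpow_def_of_pos (by positivity)]
        congr 1; ring
      rw [hcard, hMα, le_div_iff₀ (Real.exp_pos _)] at h1
      set R : ℝ := (p:ℝ)^t * (1 / (p:ℝ)^(8*t)) with hR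
      have hball : ∀ m ∈ Φ, Real.exp (-(2 * (α * Real.log p / 32) * ((8 * t : ℕ):ℝ))) ≤
          μ.real (Metric.closedBall (m • x) R) := by
        intro m hmΦ
        rw [hΦ, Set.Finite.mem_toFinset] at hmΦ
        refine h2.trans ?_
        have e1 : μ.real (Metric.closedBall (m • x) R) =
            μ.real ((fun x : AddCircle (1:ℝ) => m • x) ⁻¹' Metric.closedBall (m • x) R) := by
          rw [measureReal_def, measureReal_def, hinv m hmΦ.1 _ Metric.isClosed_closedBall.measurableSet]
        rw [e1]
        refine measureReal_mono ((arc_ball p (8*t) hp x).trans ?_)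
        intro y hy
        rw [Metric.mem_closedBall, dist_eq_norm] at hy
        rw [Set.mem_preimage, Metric.mem_closedBall, dist_eq_norm, ← smul_sub]
        refine norm_nsmul_le.trans ?_
        have : (m:ℝ) ≤ (p:ℝ)^t := by exact_mod_cast hmΦ.2.2
        rw [hR]
        gcongr
      have hsum : μ.real Set.univ < ∑ m ∈ Φ, μ.real (Metric.closedBall (m • x) R) := by
        refine lt_of_lt_of_le ?_ (Finset.sum_le_sum hball)
        rw [Finset.sum_const, nsmul_eq_mul, probReal_univ]
        calc (1:ℝ) < c * Real.exp (α * Real.log p / 2 * t) := h3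
          _ = (c * Real.exp (α * Real.log p * t)) *
              Real.exp (-(2 * (α * Real.log p / 32) * ((8 * t : ℕ):ℝ))) := by
              rw [mul_assoc, ← Real.exp_add]; congr 2; push_cast; ring
          _ ≤ _ := by gcongr
      obtain ⟨m, hmΦ, m', hm'Φ, hne, y, hy1, hy2⟩ :=
        exists_nonempty_inter_of_measureReal_univ_lt_sum_measureReal
          (fun m _ => Metric.isClosed_closedBall.measurableSet) hsum
      rw [hΦ, Set.Finite.mem_toFinset] at hmΦ hm'Φ
      rw [Metric.mem_closedBall] at hy1 hy2
      have hd : dist (m • x) (m' • x) ≤ 2 * (p:ℝ) ^ t / (p:ℝ) ^ (8 * t) := by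
        have := dist_triangle_left (m • x) (m' • x) y
        have e : 2 * (p:ℝ) ^ t / (p:ℝ) ^ (8 * t) = R + R := by rw [hR]; ring
        rw [e]; linarith
      rcases lt_or_gt_of_ne hne with h | h
      · refine ⟨m' - m, by omega, (Nat.sub_le _ _).trans hm'Φ.2.2, ?_⟩
        rw [dist_comm, dist_eq_norm] at hd
        rwa [sub_nsmul _ h.le, ← sub_eq_add_neg]
      · refine ⟨m - m', by omega, (Nat.sub_le _ _).trans hmΦ.2.2, ?_⟩
        rw [dist_eq_norm] at hd
        rwa [sub_nsmul _ h.le, ← sub_eq_add_neg]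
    obtain ⟨t0, ht0⟩ := eventually_atTop.mp hex
    choose! k hk using ht0
    rw [← coe_rep x] at hk
    obtain ⟨r, hr⟩ := torsion_of_approx p hp (rep x) t0 k (fun t ht => (hk t ht).1)
      (fun t ht => (hk t ht).2.1) (fun t ht => (hk t ht).2.2)
    exact ⟨r, by rw [← hr, coe_rep]⟩
  -- so there is an atom
  obtain ⟨r, hr⟩ : ∃ r : ℚ, 0 < μ {((r : ℝ) : AddCircle (1:ℝ))} := by
    by_contra! hcon
    have : μ Y ≤ 0 := by
      calc μ Y ≤ μ (⋃ r : ℚ, {((r : ℝ) : AddCircle (1:ℝ))}) := measure_mono (by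
            intro x hx
            obtain ⟨r, hr⟩ := hrat x hx
            exact Set.mem_iUnion.mpr ⟨r, hr⟩)
        _ ≤ ∑' r : ℚ, μ {((r : ℝ) : AddCircle (1:ℝ))} := measure_iUnion_le _
        _ = 0 := by
          rw [ENNReal.tsum_eq_zero]
          exact fun r => le_antisymm (hcon r) bot_le
    exact absurd hY (not_lt.mpr this)
  exact finite_of_atom S hS μ hinv herg p hpS _ hr
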